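/- For every point-shift F, the following are equivalent: (i) F evaporates the point process, i.e. ⋂_{n≥0} F_ω^n(ω) = ∅ for μ-almost every ω (equivalently μ_0(0 ∈ ⋂_{n≥0} F_ω^n(ω)) = 0); (ii) the foil L(0) of the origin is infinite for μ_0-almost every ω. -/

import Mathlib

open Function Set MeasureTheory ProbabilityTheory
open scoped ENNReal NNReal

namespace PointShift

/-- Points of the grid `ℤ^d`. -/
abbrev Pt (d : ℕ) := Fin d → ℤ

/-- Configurations: subsets of the grid `ℤ^d`, identified with `{0,1}`-valued
functions, equipped with the product σ-algebra. -/
abbrev Conf (d : ℕ) := Pt d → Bool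

/-- The shift `θ_t ω = ω - t`. -/
def shift {d : ℕ} (t : Pt d) (ω : Conf d) : Conf d := fun x => ω (x + t)

/-- The support of a configuration, as a subset of `ℤ^d`. -/
def pts {d : ℕ} (ω : Conf d) : Set (Pt d) := {x | ω x = true}

/-- `g` is a point-map: it is measurable and selects a point of every
configuration having a point at the origin. -/
def IsPointMap {d : ℕ} (g : Conf d → Pt d) : Prop :=
  Measurable g ∧ ∀ ω : Conf d, ω 0 = true → ω (g ω) = true

/-- The point-shift associated with a point-map `g`: `F_ω x = x + g (θ_x ω)`. -/
def Fps {d : ℕ} (g : Conf d → Pt d) (ω : Conf d) (x : Pt d) : Pt d :=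
  x + g (shift x ω)

/-- `μ` is a stationary point process on the grid: a shift-invariant probability
measure with a point at the origin with positive probability. -/
def IsStationaryPP {d : ℕ} (μ : Measure (Conf d)) : Prop :=
  IsProbabilityMeasure μ ∧ (∀ t : Pt d, μ.map (shift t) = μ) ∧
    0 < μ {ω : Conf d | ω 0 = true}

/-- The Palm probability of `μ`: `μ` conditioned on having a point at the origin. -/
noncomputable def Palm {d : ℕ} (μ : Measure (Conf d)) : Measure (Conf d) :=
  μ[|{ω : Conf d | ω 0 = true}]

/-- The foil of the point `x` in the configuration `ω`, for the point-shift of `g`. -/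
def foilOn {d : ℕ} (g : Conf d → Pt d) (ω : Conf d) (x : Pt d) : Set (Pt d) :=
  {y | ω y = true ∧ ∃ n : ℕ, (Fps g ω)^[n] y = (Fps g ω)^[n] x}

/-- The connected component of the point `x` in the functional graph `G^F(ω)`. -/
def compOn {d : ℕ} (g : Conf d → Pt d) (ω : Conf d) (x : Pt d) : Set (Pt d) :=
  {y | ω y = true ∧ ∃ m n : ℕ, (Fps g ω)^[m] x = (Fps g ω)^[n] y}

/-- `K` is a directed cycle of the functional graph of `f`: a finite set of
distinct points `c 0, …, c (k-1)` (with `k ≥ 1`) such that `f (c i) = c ((i+1) % k)`. -/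
def IsCycle {X : Type*} (f : X → X) (K : Set X) : Prop :=
  ∃ (k : ℕ) (c : ℕ → X), 0 < k ∧
    (∀ i < k, ∀ j < k, c i = c j → i = j) ∧
    (∀ i < k, f (c i) = c ((i + 1) % k)) ∧
    K = c '' {i | i < k}

end PointShift

namespace PointShift

variable {d : ℕ}

lemma measurable_shift (t : Pt d) : Measurable (shift t : Conf d → Conf d) :=
  measurable_pi_lambda _ fun x => measurable_pi_apply (x + t)

/-- The points lying in the image of every iterate of the point-shift. -/
def persistent (g : Conf d → Pt d) (ω : Conf d) : Set (Pt d) :=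
  ⋂ n : ℕ, (Fps g ω)^[n] '' pts ω

lemma mem_persistent {g : Conf d → Pt d} {ω : Conf d} {x : Pt d} :
    x ∈ persistent g ω ↔ ∀ n : ℕ, ∃ y, ω y = true ∧ (Fps g ω)^[n] y = x := by
  simp [persistent, pts]

lemma mem_of_mem_persistent {g : Conf d → Pt d} {ω : Conf d} {x : Pt d}
    (hx : x ∈ persistent g ω) : ω x = true := by
  obtain ⟨y, hy, rfl⟩ := mem_persistent.1 hx 0
  exact hy

section Equivariance

lemma shift_shift (s t : Pt d) (ω : Conf d) : shift s (shift t ω) = shift (s + t) ω := by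
  funext x
  simp [shift, add_assoc]

lemma Fps_shift (g : Conf d → Pt d) (t : Pt d) (ω : Conf d) (x : Pt d) :
    Fps g (shift t ω) x = Fps g ω (x + t) - t := by
  simp only [Fps, shift_shift]
  abel

lemma iterate_Fps_shift (g : Conf d → Pt d) (t : Pt d) (ω : Conf d) (n : ℕ) (x : Pt d) :
    (Fps g (shift t ω))^[n] x = (Fps g ω)^[n] (x + t) - t := by
  induction n with
  | zero => simp
  | succ n ih => rw [iterate_succ_apply', iterate_succ_apply', ih, Fps_shift, sub_add_cancel]

lemma forall_add_right (t : Pt d) {P : Pt d → Prop} : (∀ x, P (x + t)) ↔ ∀ x, P x :=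
  (Equiv.addRight t).surjective.forall.symm

lemma exists_add_right (t : Pt d) {P : Pt d → Prop} : (∃ x, P (x + t)) ↔ ∃ x, P x :=
  (Equiv.addRight t).surjective.exists.symm

lemma mem_persistent_shift (g : Conf d → Pt d) (t : Pt d) (ω : Conf d) (x : Pt d) :
    x ∈ persistent g (shift t ω) ↔ x + t ∈ persistent g ω := by
  simp only [mem_persistent, iterate_Fps_shift, sub_eq_iff_eq_add]
  exact forall_congr' fun n =>
    exists_add_right t (P := fun y => ω y = true ∧ (Fps g ω)^[n] y = x + t)

lemma mem_foilOn_shift (g : Conf d → Pt d) (t : Pt d) (ω : Conf d) (x y : Pt d) :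
    y ∈ foilOn g (shift t ω) x ↔ y + t ∈ foilOn g ω (x + t) := by
  simp [foilOn, iterate_Fps_shift, shift]

end Equivariance

section Measurability

lemma measurable_Fps {g : Conf d → Pt d} (hg : Measurable g) (x : Pt d) :
    Measurable fun ω => Fps g ω x :=
  (measurable_const (a := x)).add (hg.comp (measurable_shift x))

lemma measurable_iterate_Fps {g : Conf d → Pt d} (hg : Measurable g) (n : ℕ) (x : Pt d) :
    Measurable fun ω => (Fps g ω)^[n] x := by
  induction n with
  | zero => exact measurable_const
  | succ n ih =>
    simp only [iterate_succ_apply']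
    have h : Measurable fun p : Pt d × Conf d => Fps g p.2 p.1 :=
      measurable_from_prod_countable_right fun y => measurable_Fps hg y
    exact h.comp (ih.prodMk measurable_id)

lemma measurable_mem (x : Pt d) : Measurable fun ω : Conf d => ω x = true :=
  measurableSet_setOfPred.1
    (measurableSet_eq_fun (measurable_pi_apply x) measurable_const)

lemma measurable_iterate_eq {g : Conf d → Pt d} (hg : Measurable g) (n : ℕ) (x y : Pt d) :
    Measurable fun ω => (Fps g ω)^[n] x = y :=
  measurableSet_setOfPred.1 (measurable_iterate_Fps hg n x (measurableSet_singleton y))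

lemma measurable_mem_persistent {g : Conf d → Pt d} (hg : Measurable g) (x : Pt d) :
    Measurable fun ω => x ∈ persistent g ω := by
  simp only [mem_persistent]
  exact Measurable.forall fun n => Measurable.exists fun y =>
    (measurable_mem y).and (measurable_iterate_eq hg n y x)

lemma measurable_mem_foilOn {g : Conf d → Pt d} (hg : Measurable g) (x y : Pt d) :
    Measurable fun ω => y ∈ foilOn g ω x :=
  (measurable_mem y).and <| Measurable.exists fun n => measurableSet_setOfPred.1 <|
    measurableSet_eq_fun (measurable_iterate_Fps hg n y) (measurable_iterate_Fps hg n x)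

end Measurability

section MassTransport

variable {μ : Measure (Conf d)}

lemma ae_forall_of_ae_zero (hinv : ∀ t : Pt d, μ.map (shift t) = μ) {P : Conf d → Pt d → Prop}
    (hP : ∀ ω t, P (shift t ω) 0 ↔ P ω t) (h : ∀ᵐ ω ∂μ, P ω 0) : ∀ᵐ ω ∂μ, ∀ x, P ω x := by
  refine ae_all_iff.2 fun x => ?_
  rw [← hinv x] at h
  filter_upwards [ae_of_ae_map (measurable_shift x).aemeasurable h] with ω hω
  exact (hP ω x).1 hω

lemma count_eq_tsum_indicator (Q : Conf d → Pt d → Prop) (ω : Conf d) :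
    Measure.count {x | Q ω x} = ∑' x, {ω | Q ω x}.indicator (1 : Conf d → ℝ≥0∞) ω := by
  classical
  rw [← lintegral_indicator_one (MeasurableSet.of_discrete), lintegral_count]
  simp [indicator_apply]

lemma measurable_count {Q : Conf d → Pt d → Prop} (hQ : ∀ x, Measurable fun ω => Q ω x) :
    Measurable fun ω => Measure.count {x | Q ω x} := by
  simp only [count_eq_tsum_indicator]
  exact Measurable.tsum fun x => measurable_one.indicator (measurableSet_setOfPred.2 (hQ x))

lemma lintegral_count {Q : Conf d → Pt d → Prop} (hQ : ∀ x, Measurable fun ω => Q ω x) :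
    ∫⁻ ω, Measure.count {x | Q ω x} ∂μ = ∑' x, μ {ω | Q ω x} := by
  simp only [count_eq_tsum_indicator]
  rw [lintegral_tsum fun x =>
    (measurable_one.indicator (measurableSet_setOfPred.2 (hQ x))).aemeasurable]
  exact tsum_congr fun x => lintegral_indicator_one (measurableSet_setOfPred.2 (hQ x))

/-- The mass transport principle for equivariant relations on the grid. -/
lemma lintegral_count_out_eq_in (hinv : ∀ t : Pt d, μ.map (shift t) = μ)
    {R : Conf d → Pt d → Pt d → Prop} (hR : ∀ x y, Measurable fun ω => R ω x y)
    (hequi : ∀ ω t x y, R (shift t ω) x y ↔ R ω (x + t) (y + t)) :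
    ∫⁻ ω, Measure.count {y | R ω 0 y} ∂μ = ∫⁻ ω, Measure.count {x | R ω x 0} ∂μ := by
  rw [lintegral_count fun y => hR 0 y, lintegral_count fun x => hR x 0,
    ← (Equiv.neg (Pt d)).tsum_eq fun x => μ {ω | R ω x 0}]
  refine tsum_congr fun y => ?_
  conv_rhs => rw [← hinv y]
  rw [Measure.map_apply (measurable_shift y) (measurableSet_setOfPred.2 (hR _ _))]
  simp [hequi]

/-- If almost surely every point sends mass to at most one point, then almost surely every point
receives mass from finitely many points. -/
lemma ae_forall_finite_in [IsProbabilityMeasure μ] (hinv : ∀ t : Pt d, μ.map (shift t) = μ)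
    {R : Conf d → Pt d → Pt d → Prop} (hR : ∀ x y, Measurable fun ω => R ω x y)
    (hequi : ∀ ω t x y, R (shift t ω) x y ↔ R ω (x + t) (y + t))
    (hsub : ∀ᵐ ω ∂μ, {y | R ω 0 y}.Subsingleton) :
    ∀ᵐ ω ∂μ, ∀ y, {x | R ω x y}.Finite := by
  refine ae_forall_of_ae_zero hinv (P := fun ω y => {x | R ω x y}.Finite) (fun ω t => ?_) ?_
  · simp only [hequi, zero_add]
    exact ⟨fun h => h.of_preimage (f := Equiv.addRight t) (s := {x | R ω x t})
        (Equiv.addRight t).surjective,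
      fun h => h.preimage (f := Equiv.addRight t) (Equiv.addRight t).injective.injOn⟩
  have hle : ∫⁻ ω, Measure.count {x | R ω x 0} ∂μ ≤ 1 := by
    rw [← lintegral_count_out_eq_in hinv hR hequi]
    calc ∫⁻ ω, Measure.count {y | R ω 0 y} ∂μ ≤ ∫⁻ _, 1 ∂μ :=
          lintegral_mono_ae (hsub.mono fun ω h => ?_)
      _ = 1 := by simp
    rw [Measure.count_apply MeasurableSet.of_discrete]
    exact_mod_cast encard_le_one_iff_subsingleton.2 h
  filter_upwards [ae_lt_top (measurable_count fun x => hR x 0) (hle.trans_lt ENNReal.one_lt_top).ne]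
    with ω hω
  exact Measure.count_apply_lt_top.1 hω

end MassTransport

lemma ae_Palm_iff {μ : Measure (Conf d)} [IsProbabilityMeasure μ] {P : Conf d → Prop} :
    (∀ᵐ ω ∂(Palm μ), P ω) ↔ ∀ᵐ ω ∂μ, ω 0 = true → P ω := by
  rw [Palm, ProbabilityTheory.cond,
    Measure.ae_ennreal_smul_measure_iff (ENNReal.inv_ne_zero.2 (measure_ne_top μ _)),
    ae_restrict_iff' (measurableSet_setOfPred.2 (measurable_mem 0))]
  rfl

section Dynamics

variable {g : Conf d → Pt d} {ω : Conf d}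

lemma mem_Fps (hg : IsPointMap g) {x : Pt d} (hx : ω x = true) : ω (Fps g ω x) = true := by
  have h := hg.2 (shift x ω) (by simpa [shift] using hx)
  rwa [shift, add_comm] at h

lemma mem_iterate_Fps (hg : IsPointMap g) {x : Pt d} (hx : ω x = true) (n : ℕ) :
    ω ((Fps g ω)^[n] x) = true := by
  induction n with
  | zero => exact hx
  | succ n ih => rw [iterate_succ_apply']; exact mem_Fps hg ih

lemma iterate_image_antitone (hg : IsPointMap g) :
    Antitone fun n : ℕ => (Fps g ω)^[n] '' pts ω := by
  refine antitone_nat_of_succ_le fun n => ?_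
  rintro _ ⟨x, hx, rfl⟩
  exact ⟨Fps g ω x, mem_Fps hg hx, (iterate_succ_apply _ _ _).symm⟩

/-- A finite set met by all the images of the iterates contains a persistent point. -/
lemma exists_mem_persistent (hg : IsPointMap g) {s : Set (Pt d)} (hs : s.Finite)
    (h : ∀ n, ∃ y, ω y = true ∧ (Fps g ω)^[n] y ∈ s) : ∃ x ∈ s, x ∈ persistent g ω := by
  by_contra! hne
  have hleave : ∀ x ∈ s, ∃ n : ℕ, x ∉ (Fps g ω)^[n] '' pts ω := fun x hx => by
    simpa [persistent] using hne x hx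
  choose! k hk using hleave
  obtain ⟨N, hN⟩ := (hs.image k).bddAbove
  obtain ⟨y, hy, hys⟩ := h N
  exact hk _ hys (iterate_image_antitone hg (hN ⟨_, hys, rfl⟩) ⟨y, hy, rfl⟩)

lemma Fps_mem_persistent (hg : IsPointMap g) {x : Pt d} (hx : x ∈ persistent g ω) :
    Fps g ω x ∈ persistent g ω := by
  rw [mem_persistent] at hx ⊢
  intro n
  obtain ⟨y, hy, rfl⟩ := hx n
  exact ⟨Fps g ω y, mem_Fps hg hy, by rw [← iterate_succ_apply, iterate_succ_apply']⟩

lemma exists_persistent_preimage (hg : IsPointMap g) {y : Pt d} (hy : y ∈ persistent g ω)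
    (hfin : {x | ω x = true ∧ Fps g ω x = y}.Finite) :
    ∃ x ∈ persistent g ω, Fps g ω x = y := by
  obtain ⟨x, hx, hxp⟩ := exists_mem_persistent hg hfin fun n => by
    obtain ⟨z, hz, hzy⟩ := mem_persistent.1 hy (n + 1)
    exact ⟨z, hz, mem_iterate_Fps hg hz n, (iterate_succ_apply' _ _ _).symm.trans hzy⟩
  exact ⟨x, hxp, hx.2⟩

lemma mem_persistent_of_isPeriodicPt (hg : IsPointMap g) {x : Pt d} (hx : ω x = true) {p : ℕ}
    (hp : 0 < p) (h : IsPeriodicPt (Fps g ω) p x) : x ∈ persistent g ω := by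
  refine mem_persistent.2 fun n => ⟨(Fps g ω)^[p * n - n] x, mem_iterate_Fps hg hx _, ?_⟩
  rw [← iterate_add_apply, Nat.add_sub_cancel' (Nat.le_mul_of_pos_left n hp)]
  exact h.mul_const n

lemma injective_iterate (hg : IsPointMap g) (hempty : persistent g ω = ∅) {x : Pt d}
    (hx : ω x = true) : Injective fun n => (Fps g ω)^[n] x := by
  refine Injective.of_lt_imp_ne fun i j hij heq => ?_
  have h : (Fps g ω)^[i] x ∈ persistent g ω := by
    refine mem_persistent_of_isPeriodicPt hg (mem_iterate_Fps hg hx i) (Nat.sub_pos_of_lt hij) ?_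
    rw [IsPeriodicPt, IsFixedPt, ← iterate_add_apply, Nat.sub_add_cancel hij.le]
    exact heq.symm
  simp [hempty] at h

lemma self_mem_foilOn {x : Pt d} (hx : ω x = true) : x ∈ foilOn g ω x := ⟨hx, 0, rfl⟩

lemma mem_foilOn_trans {x y z : Pt d} (hxy : y ∈ foilOn g ω x) (hyz : z ∈ foilOn g ω y) :
    z ∈ foilOn g ω x := by
  obtain ⟨-, m, hm⟩ := hxy
  obtain ⟨hz, n, hn⟩ := hyz
  refine ⟨hz, n + m, ?_⟩
  rw [add_comm n m, iterate_add_apply, hn, ← iterate_add_apply, add_comm m n,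
    iterate_add_apply, hm, ← iterate_add_apply]

lemma mem_foilOn_symm {x y : Pt d} (hx : ω x = true) (hxy : y ∈ foilOn g ω x) :
    x ∈ foilOn g ω y := by
  obtain ⟨-, m, hm⟩ := hxy
  exact ⟨hx, m, hm.symm⟩

lemma iterate_mem_foilOn (hg : IsPointMap g) {x y : Pt d} (h : y ∈ foilOn g ω x) (n : ℕ) :
    (Fps g ω)^[n] y ∈ foilOn g ω ((Fps g ω)^[n] x) := by
  obtain ⟨hy, m, hm⟩ := h
  refine ⟨mem_iterate_Fps hg hy n, m, ?_⟩
  rw [← iterate_add_apply, ← iterate_add_apply, add_comm, iterate_add_apply, hm,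
    ← iterate_add_apply]

/-- `y` is the lexicographically least point of its foil, and that foil contains no image of a
point of the configuration. -/
def IsInitialLeast (g : Conf d → Pt d) (ω : Conf d) (y : Pt d) : Prop :=
  ω y = true ∧ (∀ z, z ∈ foilOn g ω y → toLex y ≤ toLex z) ∧
    ∀ w, ω w = true → Fps g ω w ∉ foilOn g ω y

lemma IsInitialLeast.eq (hg : IsPointMap g) {y z : Pt d} (hy : IsInitialLeast g ω y)
    (hz : IsInitialLeast g ω z) {m n : ℕ} (h : (Fps g ω)^[m] y = (Fps g ω)^[n] z) : y = z := by
  wlog hmn : m ≤ n generalizing y z m n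
  · exact (this hz hy h.symm (not_le.1 hmn).le).symm
  obtain ⟨k, rfl⟩ := Nat.exists_eq_add_of_le hmn
  rw [iterate_add_apply] at h
  have hmem : (Fps g ω)^[k] z ∈ foilOn g ω y := ⟨mem_iterate_Fps hg hz.1 k, m, h.symm⟩
  cases k with
  | zero =>
    exact toLex.injective
      (le_antisymm (hy.2.1 z hmem) (hz.2.1 y (mem_foilOn_symm hy.1 hmem)))
  | succ k =>
    rw [iterate_succ_apply'] at hmem
    exact (hy.2.2 _ (mem_iterate_Fps hg hz.1 k) hmem).elim

/-- Below a finite foil there is an initial one, if there are no persistent points. -/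
lemma exists_isInitialLeast (hg : IsPointMap g) (hempty : persistent g ω = ∅)
    (hfib : ∀ (n : ℕ) (y : Pt d), {x | ω x = true ∧ (Fps g ω)^[n] x = y}.Finite)
    {x : Pt d} (hx : ω x = true) (hfin : (foilOn g ω x).Finite) :
    ∃ y, IsInitialLeast g ω y := by
  classical
  have hex : ∃ n : ℕ, ∀ w, ω w = true → (Fps g ω)^[n] w ∉ foilOn g ω x := by
    by_contra! h
    obtain ⟨y, -, hy⟩ := exists_mem_persistent hg hfin h
    simp [hempty] at hy
  obtain ⟨n, hn, hmin⟩ : ∃ n : ℕ, (∀ w, ω w = true → (Fps g ω)^[n] w ∉ foilOn g ω x) ∧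
      ∀ m < n, ¬ ∀ w, ω w = true → (Fps g ω)^[m] w ∉ foilOn g ω x :=
    ⟨Nat.find hex, Nat.find_spec hex, fun m => Nat.find_min hex⟩
  cases n with
  | zero => exact (hn x hx (self_mem_foilOn hx)).elim
  | succ n =>
    have hw := hmin n n.lt_succ_self
    push Not at hw
    obtain ⟨w, hw, hwx⟩ := hw
    have hsub : foilOn g ω w ⊆
        ⋃ y ∈ foilOn g ω x, {z | ω z = true ∧ (Fps g ω)^[n] z = y} := fun z hz =>
      mem_biUnion (mem_foilOn_trans hwx (iterate_mem_foilOn hg hz n)) ⟨hz.1, rfl⟩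
    obtain ⟨y, hy, hle⟩ := exists_min_image (foilOn g ω w) toLex
      ((hfin.biUnion fun y _ => hfib n y).subset hsub) ⟨w, self_mem_foilOn hw⟩
    refine ⟨y, hy.1, fun z hz => hle z (mem_foilOn_trans hy hz), fun v hv hvy => hn v hv ?_⟩
    rw [iterate_succ_apply]
    exact mem_foilOn_trans hwx (iterate_mem_foilOn hg (mem_foilOn_trans hy hvy) n)

lemma isInitialLeast_shift (t : Pt d) (y : Pt d) :
    IsInitialLeast g (shift t ω) y ↔ IsInitialLeast g ω (y + t) := by
  simp only [IsInitialLeast, mem_foilOn_shift, Fps_shift, sub_add_cancel]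
  refine and_congr Iff.rfl (and_congr ?_ ?_)
  · rw [← forall_add_right t (P := fun z => z ∈ foilOn g ω (y + t) → toLex (y + t) ≤ toLex z)]
    simp
  · exact forall_add_right t (P := fun w => ω w = true → Fps g ω w ∉ foilOn g ω (y + t))

lemma measurable_isInitialLeast (hg : Measurable g) (y : Pt d) :
    Measurable fun ω => IsInitialLeast g ω y := by
  refine (measurable_mem y).and
    ((Measurable.forall fun z => ?_).and (Measurable.forall fun w => ?_))
  · exact (measurable_mem_foilOn hg y z).imp measurable_const
  · refine (measurable_mem w).imp (Measurable.not ?_)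
    have h : Measurable fun p : Pt d × Conf d => p.1 ∈ foilOn g p.2 y :=
      measurable_from_prod_countable_right fun z => measurable_mem_foilOn hg y z
    exact h.comp ((measurable_Fps hg w).prodMk measurable_id)

end Dynamics

section Main

variable {μ : Measure (Conf d)} [IsProbabilityMeasure μ] {g : Conf d → Pt d}

lemma ae_finite_fibers (hinv : ∀ t : Pt d, μ.map (shift t) = μ) (hg : IsPointMap g) :
    ∀ᵐ ω ∂μ, ∀ (n : ℕ) (y : Pt d), {x | ω x = true ∧ (Fps g ω)^[n] x = y}.Finite :=
  ae_all_iff.2 fun n => ae_forall_finite_in hinv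
    (R := fun ω x y => ω x = true ∧ (Fps g ω)^[n] x = y)
    (fun x y => (measurable_mem x).and (measurable_iterate_eq hg.1 n x y))
    (fun ω t x y => by simp [iterate_Fps_shift, shift, sub_eq_iff_eq_add])
    (ae_of_all _ fun ω y hy z hz => hy.2.symm.trans hz.2)

lemma ae_infinite_foilOn (hinv : ∀ t : Pt d, μ.map (shift t) = μ) (hg : IsPointMap g)
    (hempty : ∀ᵐ ω ∂μ, persistent g ω = ∅) :
    ∀ᵐ ω ∂μ, ω 0 = true → (foilOn g ω 0).Infinite := by
  have hfin : ∀ᵐ ω ∂μ, ∀ y, {x | IsInitialLeast g ω y ∧ ∃ n : ℕ, (Fps g ω)^[n] y = x}.Finite :=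
    ae_forall_finite_in hinv
      (R := fun ω x y => IsInitialLeast g ω y ∧ ∃ n : ℕ, (Fps g ω)^[n] y = x)
      (fun x y => (measurable_isInitialLeast hg.1 y).and
        (Measurable.exists fun n => measurable_iterate_eq hg.1 n y x))
      (fun ω t x y => by simp [iterate_Fps_shift, isInitialLeast_shift, sub_eq_iff_eq_add])
      (ae_of_all _ fun ω y ⟨hy, m, hm⟩ z ⟨hz, n, hn⟩ => hy.eq hg hz (hm.trans hn.symm))
  filter_upwards [hempty, hfin, ae_finite_fibers hinv hg] with ω he hf hfib h0 hfoil
  obtain ⟨y, hy⟩ := exists_isInitialLeast hg he hfib h0 hfoil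
  refine infinite_range_of_injective (injective_iterate hg he hy.1) ((hf y).subset ?_)
  rintro _ ⟨n, rfl⟩
  exact ⟨hy, n, rfl⟩

lemma ae_injOn_persistent (hinv : ∀ t : Pt d, μ.map (shift t) = μ) (hg : IsPointMap g) :
    ∀ᵐ ω ∂μ, InjOn (Fps g ω) (persistent g ω) := by
  let R : Conf d → Pt d → Pt d → Prop := fun ω x y => x ∈ persistent g ω ∧ Fps g ω x = y
  have hR : ∀ x y, Measurable fun ω => R ω x y := fun x y =>
    (measurable_mem_persistent hg.1 x).and (measurable_iterate_eq hg.1 1 x y)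
  have hequi : ∀ ω t x y, R (shift t ω) x y ↔ R ω (x + t) (y + t) := fun ω t x y => by
    simp [R, mem_persistent_shift, Fps_shift, sub_eq_iff_eq_add]
  have hout : ∀ ω, Measure.count {y | R ω 0 y} ≤ 1 := fun ω => by
    rw [Measure.count_apply MeasurableSet.of_discrete]
    have h : {y | R ω 0 y}.Subsingleton := fun y hy z hz => hy.2.symm.trans hz.2
    exact_mod_cast encard_le_one_iff_subsingleton.2 h
  have hle : ∀ᵐ ω ∂μ, Measure.count {y | R ω 0 y} ≤ Measure.count {x | R ω x 0} := by
    filter_upwards [ae_finite_fibers hinv hg] with ω hfib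
    by_cases h0 : (0 : Pt d) ∈ persistent g ω
    · obtain ⟨x, hx⟩ := exists_persistent_preimage hg h0 (hfib 1 0)
      refine (hout ω).trans ?_
      rw [Measure.count_apply MeasurableSet.of_discrete]
      have h : {x | R ω x 0}.Nonempty := ⟨x, hx⟩
      exact_mod_cast one_le_encard_iff_nonempty.2 h
    · simp [R, h0]
  have heq : ∀ᵐ ω ∂μ, Measure.count {y | R ω 0 y} = Measure.count {x | R ω x 0} := by
    refine ae_eq_of_ae_le_of_lintegral_le hle ?_ (measurable_count fun x => hR x 0).aemeasurable
      (lintegral_count_out_eq_in hinv hR hequi).ge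
    refine ne_top_of_le_ne_top ENNReal.one_ne_top
      ((lintegral_mono hout).trans (by simp))
  have hsub : ∀ᵐ ω ∂μ, ∀ y, {x | R ω x y}.Subsingleton := by
    refine ae_forall_of_ae_zero hinv (P := fun ω y => {x | R ω x y}.Subsingleton)
      (fun ω t => ?_) ?_
    · simp only [hequi, zero_add]
      refine ⟨fun h x hx z hz => ?_, fun h x hx z hz => add_right_cancel (h hx hz)⟩
      simpa using @h (x - t) (by simpa using hx) (z - t) (by simpa using hz)
    · filter_upwards [heq] with ω hω
      have h := hω ▸ hout ω
      rw [Measure.count_apply MeasurableSet.of_discrete] at h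
      exact encard_le_one_iff_subsingleton.1 (by exact_mod_cast h)
  filter_upwards [hsub] with ω hω x hx z hz hxz
  exact hω (Fps g ω z) ⟨hx, hxz⟩ ⟨hz, rfl⟩

lemma ae_persistent_eq_empty (hinv : ∀ t : Pt d, μ.map (shift t) = μ) (hg : IsPointMap g)
    (hinf : ∀ᵐ ω ∂μ, ω 0 = true → (foilOn g ω 0).Infinite) :
    ∀ᵐ ω ∂μ, persistent g ω = ∅ := by
  have hinj := ae_injOn_persistent hinv hg
  have hfin : ∀ᵐ ω ∂μ, ∀ y, {x | y ∈ persistent g ω ∧ x ∈ foilOn g ω y}.Finite := by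
    refine ae_forall_finite_in hinv (R := fun ω x y => y ∈ persistent g ω ∧ x ∈ foilOn g ω y)
      (fun x y => (measurable_mem_persistent hg.1 y).and (measurable_mem_foilOn hg.1 y x))
      (fun ω t x y => by simp [mem_persistent_shift, mem_foilOn_shift]) ?_
    filter_upwards [hinj] with ω hω
    rintro y ⟨hy, hy0⟩ z ⟨hz, hz0⟩
    obtain ⟨-, n, hn⟩ := mem_foilOn_trans hz0 (mem_foilOn_symm (mem_of_mem_persistent hy) hy0)
    exact hω.iterate (fun _ => Fps_mem_persistent hg) n hy hz hn
  have hinf' : ∀ᵐ ω ∂μ, ∀ y, ω y = true → (foilOn g ω y).Infinite := by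
    refine ae_forall_of_ae_zero hinv (P := fun ω y => ω y = true → (foilOn g ω y).Infinite)
      (fun ω t => ?_) hinf
    have h : foilOn g (shift t ω) 0 = Equiv.addRight t ⁻¹' foilOn g ω t := by
      ext y
      simp [mem_foilOn_shift]
    rw [h, shift, zero_add]
    refine imp_congr Iff.rfl (not_congr ⟨fun h => h.of_preimage (Equiv.addRight t).surjective,
      fun h => h.preimage (Equiv.addRight t).injective.injOn⟩)
  filter_upwards [hfin, hinf'] with ω hf hi
  refine eq_empty_of_forall_notMem fun y hy => hi y (mem_of_mem_persistent hy) ?_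
  exact (hf y).subset fun x hx => ⟨hy, hx⟩

lemma ae_persistent_eq_empty_iff (hinv : ∀ t : Pt d, μ.map (shift t) = μ) :
    (∀ᵐ ω ∂μ, persistent g ω = ∅) ↔ Palm μ {ω | 0 ∈ persistent g ω} = 0 := by
  rw [measure_eq_zero_iff_ae_notMem, ae_Palm_iff]
  refine ⟨fun h => h.mono fun ω hω _ => by simp [hω], fun h => ?_⟩
  refine (ae_forall_of_ae_zero hinv (P := fun ω x => x ∉ persistent g ω)
    (fun ω t => by simp [mem_persistent_shift]) ?_).mono fun ω => eq_empty_of_forall_notMem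
  exact h.mono fun ω hω h0 => hω (mem_of_mem_persistent h0) h0

lemma ae_persistent_eq_empty_iff_infinite_foilOn (hinv : ∀ t : Pt d, μ.map (shift t) = μ)
    (hg : IsPointMap g) :
    (∀ᵐ ω ∂μ, persistent g ω = ∅) ↔ ∀ᵐ ω ∂(Palm μ), (foilOn g ω 0).Infinite := by
  rw [ae_Palm_iff]
  exact ⟨ae_infinite_foilOn hinv hg, ae_persistent_eq_empty hinv hg⟩

end Main

end PointShift


/-- `F` evaporates the point process (i.e. `⋂_n F^n(ω) = ∅`
`μ`-almost surely, equivalently `μ₀(0 ∈ ⋂_n F^n(ω)) = 0`) if and only if the foil of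
the origin is infinite `μ₀`-almost surely. -/
theorem stmt_17 {d : ℕ} (hd : 0 < d)
    (μ : Measure (PointShift.Conf d)) [IsProbabilityMeasure μ]
    (hinv : ∀ t : PointShift.Pt d, μ.map (PointShift.shift t) = μ)
    (hpos : 0 < μ {ω : PointShift.Conf d | ω 0 = true})
    (g : PointShift.Conf d → PointShift.Pt d) (hg : PointShift.IsPointMap g) :
    ((∀ᵐ ω ∂μ, (⋂ n : ℕ, (PointShift.Fps g ω)^[n] '' PointShift.pts ω) = ∅) ↔
      (∀ᵐ ω ∂(PointShift.Palm μ), (PointShift.foilOn g ω 0).Infinite)) ∧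
    ((PointShift.Palm μ {ω : PointShift.Conf d |
        0 ∈ ⋂ n : ℕ, (PointShift.Fps g ω)^[n] '' PointShift.pts ω} = 0) ↔
      (∀ᵐ ω ∂(PointShift.Palm μ), (PointShift.foilOn g ω 0).Infinite)) := by
  have h := PointShift.ae_persistent_eq_empty_iff_infinite_foilOn hinv hg
  exact ⟨h, (PointShift.ae_persistent_eq_empty_iff hinv).symm.trans h⟩
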